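/- arXiv:2401.12128 — 9 statements merged into one kernel-verified Lean document; each statement's English description precedes it below -/
import Mathlib

section
/- For every γ and ε with 0 < γ < 1 and 0 < ε < 1 there exists N such that for every r ≥ N, whenever x is an element of the alternating group G of degree r satisfying |x^G| ≥ |G|^γ, then Δ(x) > (1−ε)γ. -/
/-- The number of cycles in the disjoint cycle decomposition of a permutation of `Fin r`,
counting fixed points as cycles of length 1. -/
def numCycles {r : ℕ} (x : Equiv.Perm (Fin r)) : ℕ :=
  x.cycleType.card + (r - x.support.card)

/-- `Δ(x) = (r - t(x))/r` where `t(x)` is the number of cycles of `x` (fixed points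
counted as cycles of length 1). -/
noncomputable def Delta {r : ℕ} (x : Equiv.Perm (Fin r)) : ℝ :=
  ((r : ℝ) - numCycles x) / r

lemma aux_log_fact (m : ℕ) (z : ℝ) (hz : 0 < z) :
    m * Real.log z - z ≤ Real.log (m.factorial : ℝ) := by
  have h := Real.pow_div_factorial_le_exp z hz.le m
  have hf : (0 : ℝ) < m.factorial := by exact_mod_cast m.factorial_pos
  have h2 := Real.log_le_log (by positivity) h
  rw [Real.log_exp, Real.log_div (by positivity) hf.ne', Real.log_pow] at h2
  linarith

lemma aux_count (r : ℕ) (hr : 0 < r) (m : Multiset ℕ) (hm : m.sum ≤ r) :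
    m.card * Real.log r - 3 * r ≤
      Real.log ((∏ n ∈ m.toFinset, (m.count n).factorial : ℕ) : ℝ) := by
  have hr' : (0 : ℝ) < r := by exact_mod_cast hr
  rw [Nat.cast_prod, Real.log_prod (fun n _ => by exact_mod_cast (Nat.factorial_ne_zero _))]
  have h1 : ∀ n ∈ m.toFinset, (m.count n : ℝ) * Real.log r - ((m.count n * n : ℕ) : ℝ) * Real.log 2
      - r * (1 / 2) ^ n ≤ Real.log ((m.count n).factorial : ℝ) := by
    intro n _
    have := aux_log_fact (m.count n) (r * (1 / 2) ^ n) (by positivity)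
    rw [Real.log_mul (by positivity) (by positivity), Real.log_pow, one_div, Real.log_inv] at this
    push_cast
    rw [one_div]
    linarith
  refine le_trans ?_ (Finset.sum_le_sum h1)
  rw [Finset.sum_sub_distrib, Finset.sum_sub_distrib, ← Finset.sum_mul, ← Finset.sum_mul,
    ← Finset.mul_sum]
  have h2 : (∑ n ∈ m.toFinset, (m.count n : ℝ)) = m.card := by
    exact_mod_cast Multiset.toFinset_sum_count_eq m
  have h3 : (∑ n ∈ m.toFinset, ((m.count n * n : ℕ) : ℝ)) ≤ r := by
    rw [← Nat.cast_sum]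
    have : m.sum = ∑ n ∈ m.toFinset, m.count n * n := by
      rw [Finset.sum_multiset_count]; simp
    rw [← this]; exact_mod_cast hm
  have h4 : (∑ n ∈ m.toFinset, (1 / 2 : ℝ) ^ n) ≤ 2 := by
    exact (summable_geometric_two.sum_le_tsum _ (fun n _ => by positivity)).trans
      tsum_geometric_two.le
  have h5 : Real.log 2 ≤ 1 := by linarith [Real.log_two_lt_d9]
  have h6 : 0 ≤ Real.log 2 := Real.log_nonneg (by norm_num)
  have h7 := mul_le_mul h3 h5 h6 hr'.le
  have h8 := mul_le_mul_of_nonneg_left h4 hr'.le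
  rw [h2]
  linarith

lemma aux_class (r : ℕ) (hr : 0 < r) (x : Equiv.Perm (Fin r)) :
    Real.log (Nat.card {y : Equiv.Perm (Fin r) | IsConj x y} : ℝ) ≤
      ((r : ℝ) - numCycles x) * Real.log r + 4 * r := by
  have hr' : (0 : ℝ) < r := by exact_mod_cast hr
  have hs := x.sum_cycleType_le
  have h := Equiv.Perm.card_isConj_mul_eq x
  rw [Fintype.card_fin] at h hs
  set c := Nat.card {y : Equiv.Perm (Fin r) | IsConj x y}
  have hne := Nat.factorial_ne_zero r
  rw [← h] at hne
  have hc : c ≠ 0 := fun h0 => hne (by rw [h0, zero_mul])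
  have hp : x.cycleType.prod ≠ 0 := fun h0 => hne (by rw [h0]; simp)
  have hq : (∏ n ∈ x.cycleType.toFinset, (x.cycleType.count n).factorial) ≠ 0 :=
    Finset.prod_ne_zero_iff.2 fun n _ => Nat.factorial_ne_zero _
  have hf : (r - x.cycleType.sum).factorial ≠ 0 := Nat.factorial_ne_zero _
  have hl := congrArg (fun k : ℕ => Real.log (k : ℝ)) h
  have a1 := aux_count r hr x.cycleType hs
  have a2 := aux_log_fact (r - x.cycleType.sum) r hr'
  have a3 : 0 ≤ Real.log (x.cycleType.prod : ℝ) := Real.log_natCast_nonneg _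
  have a4 : Real.log (r.factorial : ℝ) ≤ r * Real.log r := by
    rw [← Real.log_pow]
    exact Real.log_le_log (by exact_mod_cast r.factorial_pos)
      (by exact_mod_cast Nat.factorial_le_pow r)
  generalize (∏ n ∈ x.cycleType.toFinset, (x.cycleType.count n).factorial) = Q at *
  simp only [Nat.cast_mul] at hl
  rw [Real.log_mul (by exact_mod_cast hc) (by positivity),
    Real.log_mul (by positivity) (by positivity),
    Real.log_mul (by positivity) (by positivity)] at hl
  have : (numCycles x : ℝ) = x.cycleType.card + ((r - x.cycleType.sum : ℕ) : ℝ) := by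
    rw [numCycles, Equiv.Perm.sum_cycleType]; push_cast; rfl
  rw [this]
  linarith

/-- For every γ, ε with 0 < γ < 1 and 0 < ε < 1 there exists N such that
for every r ≥ N, whenever x is an element of the alternating group G of degree r
satisfying |x^G| ≥ |G|^γ, then Δ(x) > (1−ε)γ. -/
theorem delta_lower_bound_of_large_class :
    ∀ γ ε : ℝ, 0 < γ → γ < 1 → 0 < ε → ε < 1 →
      ∃ N : ℕ, ∀ r : ℕ, N ≤ r →
        ∀ x : alternatingGroup (Fin r),
          (Nat.card (alternatingGroup (Fin r)) : ℝ) ^ γ ≤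
            (Nat.card {y : alternatingGroup (Fin r) | IsConj x y} : ℝ) →
          (1 - ε) * γ < Delta (x : Equiv.Perm (Fin r)) := by
  intro γ ε hγ hγ1 hε hε1
  obtain ⟨N, hN⟩ := exists_nat_gt (Real.exp (6 / (ε * γ)))
  refine ⟨N + 2, fun r hr x hx => ?_⟩
  have hr0 : 0 < r := by omega
  have hr' : (0 : ℝ) < r := by exact_mod_cast hr0
  have hr1 : (1 : ℝ) ≤ r := by exact_mod_cast hr0
  have hlog : 6 / (ε * γ) < Real.log r := by
    rw [Real.lt_log_iff_exp_lt hr']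
    exact hN.trans_le (by exact_mod_cast (by omega : N ≤ r))
  rw [div_lt_iff₀ (by positivity)] at hlog
  have : Nontrivial (Fin r) := Fin.nontrivial_iff_two_le.2 (by omega)
  have hA := two_mul_nat_card_alternatingGroup (α := Fin r)
  rw [Nat.card_eq_fintype_card (α := Equiv.Perm (Fin r)), Fintype.card_perm, Fintype.card_fin] at hA
  have hApos : 0 < Nat.card (alternatingGroup (Fin r)) := Nat.card_pos
  have hApos' : (0 : ℝ) < Nat.card (alternatingGroup (Fin r)) := by exact_mod_cast hApos
  have hA2 : Real.log 2 + Real.log (Nat.card (alternatingGroup (Fin r)) : ℝ)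
      = Real.log (r.factorial : ℝ) := by
    rw [← hA, Nat.cast_mul, Real.log_mul (by norm_num) hApos'.ne']; norm_num
  have hfac := aux_log_fact r r hr'
  have hle : Nat.card {y : alternatingGroup (Fin r) | IsConj x y} ≤
      Nat.card {y : Equiv.Perm (Fin r) | IsConj (x : Equiv.Perm (Fin r)) y} := by
    refine Nat.card_le_card_of_injective
      (fun y => ⟨(y.1 : Equiv.Perm (Fin r)),
        (alternatingGroup (Fin r)).subtype.map_isConj y.2⟩) ?_
    intro a b hab
    apply Subtype.ext
    apply Subtype.ext
    exact (Subtype.mk.inj hab)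
  have hle' : (Nat.card (alternatingGroup (Fin r)) : ℝ) ^ γ ≤
      (Nat.card {y : Equiv.Perm (Fin r) | IsConj (x : Equiv.Perm (Fin r)) y} : ℝ) :=
    hx.trans (by exact_mod_cast hle)
  have hL := Real.log_le_log (by positivity) hle'
  rw [Real.log_rpow hApos'] at hL
  have hC := aux_class r hr0 x
  by_contra hcon
  rw [not_lt, Delta, div_le_iff₀ hr'] at hcon
  have h5 : Real.log 2 ≤ 1 := by linarith [Real.log_two_lt_d9]
  have hlr : 0 ≤ Real.log r := Real.log_nonneg hr1
  have e1 := mul_le_mul_of_nonneg_right hcon hlr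
  have e2 : γ * (r * Real.log r - 2 * r) ≤
      γ * Real.log (Nat.card (alternatingGroup (Fin r)) : ℝ) :=
    mul_le_mul_of_nonneg_left (by linarith) hγ.le
  have e3 : 6 * (r : ℝ) < Real.log r * (ε * γ) * r := mul_lt_mul_of_pos_right hlog hr'
  have e4 : γ * r ≤ r := by nlinarith
  nlinarith
end

section
/- For every positive integer n, √(2πn)·(n/e)^n ≤ n! ≤ 2·√(2πn)·(n/e)^n. -/
/-- **Stirling bounds.** For every positive integer n,
√(2πn)·(n/e)^n ≤ n! ≤ 2·√(2πn)·(n/e)^n. -/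
theorem stirling_two_sided (n : ℕ) (hn : 0 < n) :
    Real.sqrt (2 * Real.pi * n) * ((n : ℝ) / Real.exp 1) ^ n ≤ (n.factorial : ℝ) ∧
    (n.factorial : ℝ) ≤ 2 * Real.sqrt (2 * Real.pi * n) * ((n : ℝ) / Real.exp 1) ^ n := by
  refine ⟨Stirling.le_factorial_stirling n, ?_⟩
  obtain ⟨m, rfl⟩ : ∃ m, n = m + 1 := ⟨n - 1, by omega⟩
  have h1 : Stirling.stirlingSeq (m + 1) ≤ Stirling.stirlingSeq 1 :=
    Stirling.stirlingSeq'_antitone (Nat.zero_le m)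
  rw [Stirling.stirlingSeq_one] at h1
  have h2 : Real.exp 1 / √2 ≤ 2 * √Real.pi := by
    rw [div_le_iff₀ (by positivity), mul_assoc, ← Real.sqrt_mul Real.pi_pos.le]
    have h3 : (2 : ℝ) ≤ √(Real.pi * 2) :=
      Real.le_sqrt_of_sq_le (by linarith [Real.pi_gt_three])
    linarith [Real.exp_one_lt_d9]
  have h4 := h1.trans h2
  unfold Stirling.stirlingSeq at h4
  rw [div_le_iff₀ (by positivity)] at h4
  have h5 : √(2 * Real.pi * ((m + 1 : ℕ) : ℝ)) = √Real.pi * √(2 * ((m + 1 : ℕ) : ℝ)) := by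
    rw [← Real.sqrt_mul Real.pi_pos.le]
    congr 1
    ring
  rw [h5]
  calc _ ≤ _ := h4
    _ = _ := by ring
end

section
/- For every ε > 0 there exists N such that for every r ≥ N and every element x of the symmetric group H of degree r, the conjugacy class of x in H has size at least |H|^(Δ(x)(1−ε)). -/
lemma aux_fact (t r : ℕ) (h : t ≤ r) : t.factorial ^ r ≤ r.factorial ^ t := by
  induction r, h using Nat.le_induction with
  | base => exact le_rfl
  | succ n hn ih =>
    rw [pow_succ, Nat.factorial_succ, mul_pow, mul_comm]
    exact Nat.mul_le_mul
      ((Nat.factorial_le_pow t).trans (Nat.pow_le_pow_left (by omega) t)) ih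

lemma aux_prod (s : Multiset ℕ) (h : ∀ n ∈ s, 1 ≤ n) :
    s.prod * 2 ^ s.card ≤ 2 ^ s.sum := by
  induction s using Multiset.induction_on with
  | empty => simp
  | cons a s ih =>
    have h1 := ih (fun n hn => h n (Multiset.mem_cons_of_mem hn))
    have ha := h a (Multiset.mem_cons_self a s)
    have h2 : a * 2 ≤ 2 ^ a := by
      obtain ⟨b, rfl⟩ : ∃ b, a = b + 1 := ⟨a - 1, by omega⟩
      rw [pow_succ]
      have := Nat.lt_two_pow_self (n := b)
      omega
    rw [Multiset.prod_cons, Multiset.card_cons, Multiset.sum_cons, pow_add 2 a, pow_succ]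
    calc a * s.prod * (2 ^ s.card * 2) = (a * 2) * (s.prod * 2 ^ s.card) := by ring
      _ ≤ _ := Nat.mul_le_mul h2 h1

lemma aux_count_s4 (s : Multiset ℕ) (f : ℕ) :
    f.factorial * ∏ n ∈ s.toFinset, (s.count n).factorial ≤ (s.card + f).factorial := by
  have h1 := Nat.le_of_dvd (Nat.factorial_pos _)
    (Nat.prod_factorial_dvd_factorial_sum s.toFinset (fun n => s.count n))
  rw [Multiset.toFinset_sum_count_eq] at h1
  have h2 := Nat.le_of_dvd (Nat.factorial_pos _)
    (Nat.factorial_mul_factorial_dvd_factorial_add s.card f)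
  calc _ ≤ f.factorial * s.card.factorial := Nat.mul_le_mul le_rfl h1
    _ = s.card.factorial * f.factorial := mul_comm _ _
    _ ≤ _ := h2

lemma aux_event (ε : ℝ) (hε : 0 < ε) :
    ∃ N : ℕ, ∀ r : ℕ, N ≤ r → (2 : ℝ) ^ (r : ℝ) ≤ (r.factorial : ℝ) ^ ε := by
  have h := FloorSemiring.tendsto_pow_div_factorial_atTop ((2 : ℝ) ^ (1 / ε))
  obtain ⟨N, hN⟩ := Filter.eventually_atTop.1 (h.eventually (gt_mem_nhds one_pos))
  refine ⟨N, fun r hr => ?_⟩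
  have h1 := hN r hr
  have hf : (0 : ℝ) < r.factorial := by exact_mod_cast r.factorial_pos
  rw [div_lt_one hf] at h1
  have h2 := Real.rpow_le_rpow (by positivity) h1.le hε.le
  rw [← Real.rpow_natCast, ← Real.rpow_mul (by positivity), ← Real.rpow_mul (by positivity)] at h2
  convert h2 using 2
  field_simp

/-- For every ε > 0 there exists N such that for every r ≥ N and every
element x of the symmetric group H of degree r, the conjugacy class of x in H has size
at least |H|^(Δ(x)(1−ε)). -/
theorem class_size_symmetric_lower :
    ∀ ε : ℝ, 0 < ε → ∃ N : ℕ, ∀ r : ℕ, N ≤ r →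
      ∀ x : Equiv.Perm (Fin r),
        (Nat.card (Equiv.Perm (Fin r)) : ℝ) ^ (Delta x * (1 - ε)) ≤
          (Nat.card {y : Equiv.Perm (Fin r) | IsConj x y} : ℝ) := by
  intro ε hε
  obtain ⟨N, hN⟩ := aux_event ε hε
  refine ⟨max N 1, fun r hr x => ?_⟩
  have hr1 : 1 ≤ r := (le_max_right _ _).trans hr
  have hE := hN r ((le_max_left _ _).trans hr)
  have hK := Equiv.Perm.card_isConj_mul_eq x
  rw [Fintype.card_fin] at hK
  have hsum : x.cycleType.sum = x.support.card := x.sum_cycleType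
  have hsr : x.support.card ≤ r := by simpa using x.support.card_le_univ
  have hp := aux_prod x.cycleType (fun n hn => (Equiv.Perm.two_le_of_mem_cycleType hn).trans' (by norm_num))
  have hc := aux_count_s4 x.cycleType (r - x.cycleType.sum)
  have hcs : x.cycleType.card ≤ x.cycleType.sum := by
    have := Multiset.card_nsmul_le_sum (s := x.cycleType) (a := 1)
      (fun n hn => (Equiv.Perm.two_le_of_mem_cycleType hn).trans' (by norm_num))
    simpa using this
  have ht : x.cycleType.card + (r - x.cycleType.sum) = numCycles x := by
    rw [numCycles, hsum]
  rw [ht] at hc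
  have htr : numCycles x ≤ r := by omega
  have hF := aux_fact _ _ htr
  obtain ⟨k, hk⟩ : ∃ k, x.cycleType.sum = x.cycleType.card + k := ⟨_, (Nat.add_sub_cancel' hcs).symm⟩
  have hkt : r = numCycles x + k := by omega
  have hp' : x.cycleType.prod ≤ 2 ^ k := by
    rw [hk, pow_add, mul_comm] at hp
    exact Nat.le_of_mul_le_mul_left hp (by positivity)
  set t := numCycles x with htdef
  set K := Nat.card {y : Equiv.Perm (Fin r) | IsConj x y} with hKdef
  have hmain : r.factorial ≤ K * (2 ^ k * t.factorial) := by
    rw [← hK, mul_assoc]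
    apply Nat.mul_le_mul le_rfl
    calc _ = x.cycleType.prod * ((r - x.cycleType.sum).factorial * ∏ n ∈ x.cycleType.toFinset, (x.cycleType.count n).factorial) := by ring
      _ ≤ _ := Nat.mul_le_mul hp' hc
  have hA : (Nat.card (Equiv.Perm (Fin r)) : ℝ) = r.factorial := by
    rw [Nat.card_perm, Nat.card_fin]
  rw [hA]
  have hr0 : (0 : ℝ) < r := by exact_mod_cast hr1
  have hD : Delta x = k / r := by
    rw [Delta, ← htdef]
    congr 1
    rw [sub_eq_iff_eq_add]; exact_mod_cast (by omega : r = k + t)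
  rw [hD]
  have hApos : (0 : ℝ) < r.factorial := by exact_mod_cast r.factorial_pos
  have hT : (t.factorial : ℝ) ≤ (r.factorial : ℝ) ^ ((t : ℝ) / r) := by
    have h1 : (t.factorial : ℝ) ^ r ≤ (r.factorial : ℝ) ^ t := by exact_mod_cast hF
    have h2 := Real.rpow_le_rpow (by positivity) h1 (by positivity : (0 : ℝ) ≤ 1 / r)
    rw [← Real.rpow_natCast, ← Real.rpow_natCast, ← Real.rpow_mul (by positivity),
      ← Real.rpow_mul (by positivity), mul_one_div_cancel hr0.ne', Real.rpow_one,
      mul_one_div] at h2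
    exact h2
  have h2k : (2 : ℝ) ^ k ≤ (r.factorial : ℝ) ^ (ε * (k / r)) := by
    have h2 := Real.rpow_le_rpow (by positivity) hE (by positivity : (0 : ℝ) ≤ k / r)
    rw [← Real.rpow_mul (by positivity), ← Real.rpow_mul (by positivity),
      mul_div_cancel₀ _ hr0.ne', Real.rpow_natCast] at h2
    exact h2
  have hm : (r.factorial : ℝ) ≤ K * (2 ^ k * t.factorial) := by exact_mod_cast hmain
  have hm2 : (r.factorial : ℝ) ≤
      K * ((r.factorial : ℝ) ^ (ε * (k / r)) * (r.factorial : ℝ) ^ ((t : ℝ) / r)) :=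
    hm.trans (by gcongr)
  rw [← Real.rpow_add hApos] at hm2
  have hpos : (0 : ℝ) < (r.factorial : ℝ) ^ (ε * (k / r) + (t : ℝ) / r) := by positivity
  refine le_of_mul_le_mul_right ?_ hpos
  rw [← Real.rpow_add hApos]
  have he : (k : ℝ) / r * (1 - ε) + (ε * (k / r) + (t : ℝ) / r) = 1 := by
    have : (r : ℝ) = t + k := by exact_mod_cast hkt
    field_simp
    linarith
  rw [he, Real.rpow_one]
  exact hm2
end

section
/- Let x be a permutation of r points and for each 1 ≤ i ≤ r let c_i denote the number of cycles of length i in the disjoint cycle decomposition of x (counting fixed points as cycles of length 1). Then ∏_{i=1}^{r} i^{c_i} ≤ e^{2(r − t)/e}, where t = ∑_{i=1}^{r} c_i is the total number of cycles of x. -/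
/-- The number of cycles of length `i` in the disjoint cycle decomposition of a
permutation of `Fin r`, counting fixed points as cycles of length 1. -/
def cycleCount {r : ℕ} (x : Equiv.Perm (Fin r)) (i : ℕ) : ℕ :=
  if i = 1 then r - x.support.card else Multiset.count i x.cycleType

theorem aux_bound (i : ℕ) (hi : 1 ≤ i) :
    (i : ℝ) ≤ Real.exp (2 * ((i : ℝ) - 1) / Real.exp 1) := by
  rcases Nat.eq_or_lt_of_le hi with h | h
  · subst h; simp
  · have h2 : (2 : ℝ) ≤ i := by exact_mod_cast h
    have he := Real.exp_pos 1
    have h3 : (i : ℝ) / Real.exp 1 ≤ Real.exp ((i : ℝ) / Real.exp 1 - 1) := by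
      have := Real.add_one_le_exp ((i : ℝ) / Real.exp 1 - 1)
      linarith
    rw [Real.exp_sub, div_le_div_iff_of_pos_right he] at h3
    refine h3.trans (Real.exp_le_exp.mpr ?_)
    rw [div_le_div_iff_of_pos_right he]
    linarith

theorem aux_sum (r : ℕ) (x : Equiv.Perm (Fin r)) :
    ∑ i ∈ Finset.Icc 1 r, cycleCount x i * i ≤ r := by
  have hc : x.support.card ≤ r := by simpa using Finset.card_le_univ x.support
  have h1 : ∀ i, cycleCount x i * i =
      (if i = 1 then r - x.support.card else 0) + Multiset.count i x.cycleType * i := by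
    intro i
    unfold cycleCount
    split_ifs with h
    · subst h
      have : Multiset.count 1 x.cycleType = 0 := by
        rw [Multiset.count_eq_zero]
        intro hm
        have := Equiv.Perm.two_le_of_mem_cycleType hm
        omega
      simp [this]
    · simp
  have hsub : x.cycleType.toFinset ⊆ Finset.Icc 1 r := by
    intro i hi
    rw [Multiset.mem_toFinset] at hi
    have h2 := Equiv.Perm.two_le_of_mem_cycleType hi
    have h3 := Multiset.le_sum_of_mem hi
    rw [Equiv.Perm.sum_cycleType] at h3
    rw [Finset.mem_Icc]
    omega
  have h4 := Finset.sum_multiset_count_of_subset x.cycleType (Finset.Icc 1 r) hsub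
  rw [Equiv.Perm.sum_cycleType] at h4
  simp only [smul_eq_mul] at h4
  rw [Finset.sum_congr rfl (fun i _ => h1 i), Finset.sum_add_distrib, ← h4,
    Finset.sum_ite_eq']
  split_ifs <;> omega

/-- If c_i is the number of cycles of length i of a permutation x of r
points and t = ∑_{i=1}^r c_i is the total number of cycles, then
∏_{i=1}^{r} i^{c_i} ≤ e^{2(r − t)/e}. -/
theorem prod_cycle_lengths_le (r : ℕ) (x : Equiv.Perm (Fin r)) (t : ℕ)
    (ht : t = ∑ i ∈ Finset.Icc 1 r, cycleCount x i) :
    (∏ i ∈ Finset.Icc 1 r, (i : ℝ) ^ cycleCount x i) ≤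
      Real.exp (2 * ((r : ℝ) - t) / Real.exp 1) := by
  have hs : ((∑ i ∈ Finset.Icc 1 r, cycleCount x i * i : ℕ) : ℝ) ≤ r := by
    exact_mod_cast aux_sum r x
  calc (∏ i ∈ Finset.Icc 1 r, (i : ℝ) ^ cycleCount x i)
      ≤ ∏ i ∈ Finset.Icc 1 r, Real.exp (2 * ((i : ℝ) - 1) / Real.exp 1) ^ cycleCount x i := by
        refine Finset.prod_le_prod (fun i _ => by positivity) (fun i hi => ?_)
        exact pow_le_pow_left₀ (by positivity) (aux_bound i (Finset.mem_Icc.mp hi).1) _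
    _ = Real.exp (∑ i ∈ Finset.Icc 1 r,
          (cycleCount x i : ℝ) * (2 * ((i : ℝ) - 1) / Real.exp 1)) := by
        rw [Real.exp_sum]
        exact Finset.prod_congr rfl (fun i _ => (Real.exp_nat_mul _ _).symm)
    _ = Real.exp (2 * (((∑ i ∈ Finset.Icc 1 r, cycleCount x i * i : ℕ) : ℝ) - t)
          / Real.exp 1) := by
        congr 1
        subst ht
        push_cast
        rw [← Finset.sum_sub_distrib, Finset.mul_sum, Finset.sum_div]
        exact Finset.sum_congr rfl (fun i _ => by ring)
    _ ≤ _ := by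
        gcongr
end

section
/- Let x be a permutation of r points, let t be the total number of cycles in its disjoint cycle decomposition (counting fixed points as cycles of length 1), and let Δ(x) = (r − t)/r. Then t! ≤ 2·(2πr)^(Δ(x)/2)·(r!)^(1−Δ(x)). -/
theorem numCycles_le_aux {r : ℕ} (x : Equiv.Perm (Fin r)) : numCycles x ≤ r := by
  have h1 : x.cycleType.card ≤ x.support.card := by
    rw [← Equiv.Perm.sum_cycleType]
    have := Multiset.card_nsmul_le_sum (s := x.cycleType) (a := 1)
      (fun n hn => le_trans (by norm_num) (Equiv.Perm.two_le_of_mem_cycleType hn))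
    simpa using this
  have h2 : x.support.card ≤ r := by
    simpa using Finset.card_le_univ x.support
  unfold numCycles
  omega

theorem factorial_upper_aux (t : ℕ) (ht : 1 ≤ t) :
    (t.factorial : ℝ) ≤ 2 * √(2 * Real.pi * t) * (t / Real.exp 1) ^ t := by
  obtain ⟨n, rfl⟩ : ∃ n, t = n + 1 := ⟨t - 1, by omega⟩
  have h := Stirling.stirlingSeq'_antitone (Nat.zero_le n)
  simp only [Function.comp, Nat.succ_eq_add_one, zero_add, Stirling.stirlingSeq_one] at h
  unfold Stirling.stirlingSeq at h
  rw [div_le_iff₀ (by positivity)] at h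
  refine h.trans ?_
  rw [← mul_assoc]
  refine mul_le_mul_of_nonneg_right ?_ (by positivity)
  rw [Real.sqrt_mul (by norm_num), Real.sqrt_mul (by positivity)]
  have h2 : (0:ℝ) < √2 := by positivity
  have h3 : Real.exp 1 / √2 * (√2 * √((n + 1 : ℕ) : ℝ)) = Real.exp 1 * √((n + 1 : ℕ) : ℝ) := by
    field_simp
  rw [h3, ← mul_assoc]
  refine mul_le_mul_of_nonneg_right ?_ (by positivity)
  have h4 : (2:ℝ) ≤ √(2 * Real.pi) := by
    apply Real.le_sqrt_of_sq_le
    nlinarith [Real.pi_gt_three]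
  linarith [Real.exp_one_lt_d9]

/-- If t is the total number of cycles of a permutation x of r points
(fixed points counted as cycles of length 1) and Δ(x) = (r − t)/r, then
t! ≤ 2·(2πr)^(Δ(x)/2)·(r!)^(1−Δ(x)). -/
theorem factorial_numCycles_le (r : ℕ) (x : Equiv.Perm (Fin r)) (t : ℕ)
    (ht : t = numCycles x) :
    (t.factorial : ℝ) ≤
      2 * (2 * Real.pi * r) ^ (Delta x / 2) * (r.factorial : ℝ) ^ (1 - Delta x) := by
  have htr : t ≤ r := ht ▸ numCycles_le_aux x
  rcases Nat.eq_zero_or_pos r with hr | hr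
  · subst hr
    have : t = 0 := by omega
    subst this
    simp [Delta]
  have hr' : (0:ℝ) < r := by exact_mod_cast hr
  have hr1 : (1:ℝ) ≤ r := by exact_mod_cast hr
  have hpi := Real.pi_gt_three
  have hP : (0:ℝ) < 2 * Real.pi * r := by positivity
  have hD : 1 - Delta x = t / r := by
    unfold Delta
    rw [← ht]
    field_simp
    ring
  have hD2 : Delta x / 2 = 1 / 2 - 1 / 2 * ((t:ℝ) / r) := by linarith
  have hlow := Real.rpow_le_rpow (by positivity) (Stirling.le_factorial_stirling r)
    (show (0:ℝ) ≤ t / r by positivity)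
  have hS : (√(2 * Real.pi * r) * (r / Real.exp 1) ^ r) ^ ((t:ℝ) / r)
      = (2 * Real.pi * r) ^ (1 / 2 * ((t:ℝ) / r)) * (r / Real.exp 1) ^ t := by
    rw [Real.mul_rpow (by positivity) (by positivity), Real.sqrt_eq_rpow,
      ← Real.rpow_mul hP.le, ← Real.rpow_natCast, ← Real.rpow_mul (by positivity),
      mul_div_cancel₀ _ hr'.ne', Real.rpow_natCast]
  rw [hS] at hlow
  have key : (t.factorial : ℝ) ≤ 2 * √(2 * Real.pi * r) * (r / Real.exp 1) ^ t := by
    rcases Nat.eq_zero_or_pos t with h0 | h0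
    · rw [h0]
      have : (1:ℝ) ≤ √(2 * Real.pi * r) := by
        apply Real.le_sqrt_of_sq_le
        nlinarith
      simp
      simp at this
      linarith
    · refine (factorial_upper_aux t h0).trans ?_
      have : (t:ℝ) ≤ r := by exact_mod_cast htr
      gcongr
  refine key.trans ?_
  rw [hD]
  refine le_trans (le_of_eq ?_) (mul_le_mul_of_nonneg_left hlow (by positivity))
  rw [hD2, Real.sqrt_eq_rpow]
  have : (2 * Real.pi * r) ^ ((1:ℝ) / 2) = (2 * Real.pi * r) ^ (1 / 2 - 1 / 2 * ((t:ℝ) / r)) *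
      (2 * Real.pi * r) ^ (1 / 2 * ((t:ℝ) / r)) := by
    rw [← Real.rpow_add hP]
    congr 1
    ring
  rw [this]
  ring
end

section
/- There exists δ > 0 such that whenever G is a finite alternating group of degree at least 5 and x₁, …, x_k ∈ G satisfy |x₁^G| ⋯ |x_k^G| ≤ |G|^δ, then there exists z ∈ x₁^G ⋯ x_k^G (the product set of the k conjugacy classes) with Δ(z) = Δ(x₁) + … + Δ(x_k). -/
open Equiv Equiv.Perm in
theorem ext_alt {r : ℕ} {ι : Type} [Fintype ι] (u v : ι ↪ Fin r) (h : Fintype.card ι + 2 ≤ r) :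
    ∃ g : alternatingGroup (Fin r), ∀ i, (g : Perm (Fin r)) (u i) = v i := by
  have h0 := alternatingGroup.isMultiplyPretransitive (Fin r)
  have h1 : MulAction.IsMultiplyPretransitive (alternatingGroup (Fin r)) (Fin r)
      (Fintype.card ι) := by
    apply MulAction.isMultiplyPretransitive_of_le (n := Nat.card (Fin r) - 2)
    · simp; omega
    · simp
  rw [MulAction.isMultiplyPretransitive_iff] at h1
  let e := (Fintype.equivFin ι).symm
  obtain ⟨g, hg⟩ := h1 (e.toEmbedding.trans u) (e.toEmbedding.trans v)
  refine ⟨g, fun i => ?_⟩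
  have := DFunLike.congr_fun hg (e.symm i)
  simpa [Function.Embedding.smul_apply, Subgroup.smul_def] using this

open Equiv Equiv.Perm in
theorem exists_indep {r : ℕ} (x : Perm (Fin r)) (m : ℕ) (hm : 3 * m ≤ x.support.card + 2) :
    ∃ A : Finset (Fin r), A.card = m ∧ ∀ a ∈ A, x a ∉ A := by
  obtain ⟨A, -, hA⟩ := Finset.exists_le_maximal
    (Finset.univ.filter fun A : Finset (Fin r) => ∀ a ∈ A, x a ∉ A) (a := ∅) (by simp)
  have hAi : ∀ a ∈ A, x a ∉ A := by simpa using hA.1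
  have hsub : x.support ⊆ (A ∪ A.image x) ∪ A.image x.symm := by
    intro a ha
    by_contra hcon
    simp only [Finset.mem_union, Finset.mem_image, not_or, not_exists, not_and] at hcon
    obtain ⟨⟨h1, h2⟩, h3⟩ := hcon
    have hxa : x a ≠ a := by simpa using ha
    have hmem : insert a A ∈ (Finset.univ.filter fun A : Finset (Fin r) => ∀ a ∈ A, x a ∉ A) := by
      simp only [Finset.mem_filter, Finset.mem_univ, true_and, Finset.mem_insert]
      rintro b (rfl | hb) (h | h)
      · exact hxa h
      · exact h3 _ h (by simp)
      · exact h2 _ hb h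
      · exact hAi b hb h
    have := hA.2 hmem (Finset.subset_insert a A)
    exact h1 (this (Finset.mem_insert_self a A))
  have hc := Finset.card_le_card hsub
  have c1 := Finset.card_union_le (A ∪ A.image x) (A.image x.symm)
  have c2 := Finset.card_union_le A (A.image x)
  have c3 := Finset.card_image_le (s := A) (f := x)
  have c4 := Finset.card_image_le (s := A) (f := x.symm)
  obtain ⟨B, hB, hBc⟩ := Finset.exists_subset_card_eq (s := A) (n := m) (by omega)
  exact ⟨B, hBc, fun a ha h => hAi a (hB ha) (hB h)⟩

open Equiv Equiv.Perm in
theorem class_lower {r : ℕ} (x : alternatingGroup (Fin r)) (A : Finset (Fin r))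
    (hA : ∀ a ∈ A, (x : Perm (Fin r)) a ∉ A) (h : 2 * A.card + 2 ≤ r) :
    (r - 2 * A.card) ^ A.card ≤
      Nat.card {y : alternatingGroup (Fin r) | IsConj x y} := by
  classical
  have key : ∀ f : A ↪ {b : Fin r // b ∉ A}, ∃ y : alternatingGroup (Fin r),
      IsConj x y ∧ ∀ a : A, (y : Perm (Fin r)) a = f a := by
    intro f
    let u : A ⊕ A ↪ Fin r := ⟨Sum.elim (fun a => (a : Fin r)) (fun a => (x : Perm (Fin r)) a), by
      rintro (a | a) (b | b) hab
      · exact congrArg Sum.inl (Subtype.ext hab)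
      · exact absurd (show (x : Perm (Fin r)) b ∈ A from (show (a : Fin r) = (x : Perm (Fin r)) b from hab) ▸ a.2) (hA b b.2)
      · exact absurd (show (x : Perm (Fin r)) a ∈ A from (show (x : Perm (Fin r)) a = b from hab).symm ▸ b.2) (hA a a.2)
      · exact congrArg Sum.inr (Subtype.ext ((x : Perm (Fin r)).injective hab))⟩
    let v : A ⊕ A ↪ Fin r := ⟨Sum.elim (fun a => (a : Fin r)) (fun a => (f a : Fin r)), by
      rintro (a | a) (b | b) hab
      · exact congrArg Sum.inl (Subtype.ext hab)
      · exact absurd ((show (a : Fin r) = f b from hab) ▸ a.2) (f b).2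
      · exact absurd ((show (f a : Fin r) = b from hab).symm ▸ b.2) (f a).2
      · exact congrArg Sum.inr (f.injective (Subtype.ext hab))⟩
    obtain ⟨g, hg⟩ := ext_alt u v (by simp; omega)
    refine ⟨g * x * g⁻¹, isConj_iff.2 ⟨g, rfl⟩, fun a => ?_⟩
    have h1 : (g : Perm (Fin r)) a = a := hg (Sum.inl a)
    have h2 : (g : Perm (Fin r)) ((x : Perm (Fin r)) a) = f a := hg (Sum.inr a)
    have h3 : (g : Perm (Fin r))⁻¹ a = a := by rw [Perm.inv_eq_iff_eq, h1]
    simp only [Subgroup.coe_mul, Subgroup.coe_inv, Perm.mul_apply, h3, h2]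
  choose F hF1 hF2 using key
  have hinj : Function.Injective (fun f => (⟨F f, hF1 f⟩ :
      {y : alternatingGroup (Fin r) | IsConj x y})) := by
    intro f f' hff
    have : F f = F f' := congrArg Subtype.val hff
    ext a
    rw [← hF2 f a, ← hF2 f' a, this]
  have hc := Nat.card_le_card_of_injective _ hinj
  refine le_trans ?_ hc
  rw [Nat.card_eq_fintype_card, Fintype.card_embedding_eq]
  have e1 : Fintype.card {b : Fin r // b ∉ A} = r - A.card := by
    rw [Fintype.card_subtype_compl]; simp
  rw [e1, Fintype.card_coe]
  refine le_trans ?_ (Nat.pow_sub_le_descFactorial _ _)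
  exact Nat.pow_le_pow_left (by omega) _

open Equiv Equiv.Perm in
theorem class_lower_rpow {r : ℕ} (hr : 5 ≤ r) (x : alternatingGroup (Fin r)) :
    (r : ℝ) ^ (((x : Perm (Fin r)).support.card : ℝ) / 16) ≤
      (Nat.card {y : alternatingGroup (Fin r) | IsConj x y} : ℝ) := by
  set s := (x : Perm (Fin r)).support.card with hs
  have hsr : s ≤ r := by simpa using Finset.card_le_univ (x : Perm (Fin r)).support
  have hr' : (5 : ℝ) ≤ r := by exact_mod_cast hr
  obtain ⟨m, hm1, hm2, hm3⟩ : ∃ m, 3 * m ≤ s + 2 ∧ 4 * m ≤ r ∧ s ≤ 8 * m := by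
    by_cases h0 : s = 0
    · exact ⟨0, by omega, by omega, by omega⟩
    by_cases h4 : s < 4
    · exact ⟨1, by omega, by omega, by omega⟩
    · exact ⟨s / 4, by omega, by omega, by omega⟩
  obtain ⟨A, hAm, hA⟩ := exists_indep (x : Perm (Fin r)) m hm1
  have hl := class_lower x A hA (by omega)
  rw [hAm] at hl
  have hl' : ((r - 2 * m : ℕ) : ℝ) ^ m ≤
      (Nat.card {y : alternatingGroup (Fin r) | IsConj x y} : ℝ) := by exact_mod_cast hl
  refine le_trans ?_ hl'
  have hbase : (r : ℝ) ^ (1 / 2 : ℝ) ≤ ((r - 2 * m : ℕ) : ℝ) := by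
    rw [← Real.sqrt_eq_rpow, Real.sqrt_le_iff]
    refine ⟨by positivity, ?_⟩
    have : (r : ℝ) ≤ 2 * ((r - 2 * m : ℕ) : ℝ) := by
      exact_mod_cast (by omega : r ≤ 2 * (r - 2 * m))
    nlinarith
  calc (r : ℝ) ^ ((s : ℝ) / 16) ≤ (r : ℝ) ^ ((1 / 2 : ℝ) * m) := by
        apply Real.rpow_le_rpow_of_exponent_le (by linarith)
        have : (s : ℝ) ≤ 8 * m := by exact_mod_cast hm3
        linarith
    _ = ((r : ℝ) ^ (1 / 2 : ℝ)) ^ m := by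
        rw [Real.rpow_mul (by linarith), Real.rpow_natCast]
    _ ≤ _ := pow_le_pow_left₀ (by positivity) hbase m

open Equiv Equiv.Perm in
theorem Delta_eq {r : ℕ} (x : Perm (Fin r)) :
    Delta x = ((x.support.card : ℝ) - x.cycleType.card) / r := by
  have hsr : x.support.card ≤ r := by simpa using Finset.card_le_univ x.support
  unfold Delta numCycles
  push_cast [Nat.cast_sub hsr]
  ring

open Equiv Equiv.Perm in
theorem disjoint_build {r : ℕ} : ∀ (k : ℕ) (x : Fin k → alternatingGroup (Fin r)),
    (∑ i, (x i : Perm (Fin r)).support.card) + 2 ≤ r →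
    ∃ g : Fin k → alternatingGroup (Fin r), (∀ i, IsConj (x i) (g i)) ∧
      (((List.ofFn g).prod : alternatingGroup (Fin r)) : Perm (Fin r)).support.card =
        ∑ i, (x i : Perm (Fin r)).support.card ∧
      Delta (((List.ofFn g).prod : alternatingGroup (Fin r)) : Perm (Fin r)) =
        ∑ i, Delta (x i : Perm (Fin r)) := by
  intro k
  induction k with
  | zero => intro x _; exact ⟨x, fun i => i.elim0, by simp, by simp [Delta_eq]⟩
  | succ k ih =>
    intro x hx
    rw [Fin.sum_univ_succ] at hx
    obtain ⟨g, hg, hs, hD⟩ := ih (fun i => x i.succ) (by omega)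
    set z := (List.ofFn g).prod with hz
    set S := (x 0 : Perm (Fin r)).support with hS
    have hle : Fintype.card S ≤ Fintype.card ((z : Perm (Fin r)).supportᶜ : Finset (Fin r)) := by
      rw [Fintype.card_coe, Fintype.card_coe, Finset.card_compl, Fintype.card_fin]
      omega
    obtain ⟨f⟩ := Function.Embedding.nonempty_of_card_le hle
    obtain ⟨c, hc⟩ := ext_alt (Function.Embedding.subtype (· ∈ S))
      (f.trans (Function.Embedding.subtype _)) (by rw [Fintype.card_coe]; omega)
    have hdis : Perm.Disjoint ((c * x 0 * c⁻¹ : alternatingGroup (Fin r)) : Perm (Fin r))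
        (z : Perm (Fin r)) := by
      rw [disjoint_iff_disjoint_support, Subgroup.coe_mul, Subgroup.coe_mul, Subgroup.coe_inv,
        support_conj, Finset.disjoint_left]
      intro b hb
      obtain ⟨a, ha, rfl⟩ := Finset.mem_map.1 hb
      have h1 := hc ⟨a, ha⟩
      have h2 := (f ⟨a, ha⟩).2
      rw [Finset.mem_compl] at h2
      simp only [Function.Embedding.trans_apply, Function.Embedding.subtype_apply] at h1
      rw [← h1] at h2
      exact h2
    have hcs : ((c * x 0 * c⁻¹ : alternatingGroup (Fin r)) : Perm (Fin r)).support.card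
        = S.card := by
      rw [Subgroup.coe_mul, Subgroup.coe_mul, Subgroup.coe_inv, card_support_conj]
    have hct : ((c * x 0 * c⁻¹ : alternatingGroup (Fin r)) : Perm (Fin r)).cycleType
        = (x 0 : Perm (Fin r)).cycleType := by
      rw [Subgroup.coe_mul, Subgroup.coe_mul, Subgroup.coe_inv, cycleType_conj]
    have hprod : (List.ofFn (Fin.cons (c * x 0 * c⁻¹) g : Fin (k + 1) → alternatingGroup (Fin r))).prod
        = (c * x 0 * c⁻¹) * z := by
      simp [List.ofFn_succ, hz]
    refine ⟨Fin.cons (c * x 0 * c⁻¹) g, ?_, ?_, ?_⟩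
    · intro i
      refine Fin.cases ?_ (fun j => ?_) i
      · exact isConj_iff.2 ⟨c, rfl⟩
      · simpa using hg j
    · rw [hprod, Subgroup.coe_mul, hdis.card_support_mul, hcs, hs, Fin.sum_univ_succ]
    · rw [hprod, Fin.sum_univ_succ, ← hD, Delta_eq, Delta_eq, Delta_eq, Subgroup.coe_mul,
        hdis.card_support_mul, hdis.cycleType_mul, hcs, hct, Multiset.card_add]
      push_cast
      ring

/-- There exists δ > 0 such that whenever G is a finite alternating
group of degree at least 5 and x₁, …, x_k ∈ G satisfy |x₁^G| ⋯ |x_k^G| ≤ |G|^δ, then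
there exists z ∈ x₁^G ⋯ x_k^G with Δ(z) = Δ(x₁) + … + Δ(x_k). -/
theorem additivity_of_delta_in_class_products :
    ∃ δ : ℝ, 0 < δ ∧
      ∀ r : ℕ, 5 ≤ r → ∀ k : ℕ, ∀ x : Fin k → alternatingGroup (Fin r),
        (∏ i, (Nat.card {y : alternatingGroup (Fin r) | IsConj (x i) y} : ℝ)) ≤
          (Nat.card (alternatingGroup (Fin r)) : ℝ) ^ δ →
        ∃ z : alternatingGroup (Fin r),
          (∃ g : Fin k → alternatingGroup (Fin r),
            (∀ i, IsConj (x i) (g i)) ∧ z = (List.ofFn g).prod) ∧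
          Delta (z : Equiv.Perm (Fin r)) = ∑ i, Delta ((x i : Equiv.Perm (Fin r))) := by
  refine ⟨1 / 32, by norm_num, fun r hr k x hx => ?_⟩
  have hr' : (5 : ℝ) ≤ r := by exact_mod_cast hr
  have h1 : (r : ℝ) ^ (∑ i, ((x i : Equiv.Perm (Fin r)).support.card : ℝ) / 16) ≤
      (Nat.card (alternatingGroup (Fin r)) : ℝ) ^ (1 / 32 : ℝ) := by
    refine le_trans ?_ hx
    rw [Real.rpow_sum_of_pos (by linarith)]
    exact Finset.prod_le_prod (fun i _ => by positivity) fun i _ => class_lower_rpow hr (x i)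
  have h2 : (Nat.card (alternatingGroup (Fin r)) : ℝ) ≤ (r : ℝ) ^ (r : ℝ) := by
    have a1 : Nat.card (alternatingGroup (Fin r)) ≤ Nat.card (Equiv.Perm (Fin r)) :=
      Nat.card_le_card_of_injective _ Subtype.val_injective
    have a2 : Nat.card (Equiv.Perm (Fin r)) = r.factorial := by
      rw [Nat.card_eq_fintype_card, Fintype.card_perm, Fintype.card_fin]
    rw [Real.rpow_natCast]
    exact_mod_cast (a1.trans a2.le).trans (Nat.factorial_le_pow r)
  have h3 : (r : ℝ) ^ (∑ i, ((x i : Equiv.Perm (Fin r)).support.card : ℝ) / 16) ≤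
      (r : ℝ) ^ ((r : ℝ) * (1 / 32)) := by
    refine h1.trans ?_
    rw [Real.rpow_mul (by linarith)]
    exact Real.rpow_le_rpow (by positivity) h2 (by norm_num)
  have h4 := (Real.rpow_le_rpow_left_iff (by linarith)).1 h3
  rw [← Finset.sum_div] at h4
  have h5 : 2 * ∑ i, (x i : Equiv.Perm (Fin r)).support.card ≤ r := by
    have : 2 * ∑ i, ((x i : Equiv.Perm (Fin r)).support.card : ℝ) ≤ r := by linarith
    exact_mod_cast this
  obtain ⟨g, hg, -, hD⟩ := disjoint_build k x (by omega)
  exact ⟨_, ⟨g, hg, rfl⟩, hD⟩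
end

section
/- If x, y are elements of the alternating group G of degree r with Δ(x) < 1/4 and Δ(y) < 1/4, then the product set x^G·y^G contains a conjugacy class z^G of an element z ∈ G satisfying Δ(z) = Δ(x) + Δ(y). -/
open Pointwise

theorem aux_two_card {r : ℕ} (x : Equiv.Perm (Fin r)) :
    2 * x.cycleType.card ≤ x.support.card := by
  have h := Multiset.card_nsmul_le_sum (s := x.cycleType) (a := 2)
    (fun n hn => Equiv.Perm.two_le_of_mem_cycleType hn)
  rw [Equiv.Perm.sum_cycleType] at h
  simpa [mul_comm] using h

theorem aux_supp_le {r : ℕ} (x : Equiv.Perm (Fin r)) : x.support.card ≤ r := by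
  simpa using Finset.card_le_univ x.support

theorem aux_Delta {r : ℕ} (x : Equiv.Perm (Fin r)) :
    Delta x = ((x.support.card : ℝ) - x.cycleType.card) / r := by
  unfold Delta numCycles
  congr 1
  rw [Nat.cast_add, Nat.cast_sub (aux_supp_le x)]
  ring

theorem aux_small {r : ℕ} (hr : 0 < r) (x : Equiv.Perm (Fin r)) (h : Delta x < 1 / 4) :
    2 * x.support.card < r := by
  rw [aux_Delta, div_lt_iff₀ (by exact_mod_cast hr)] at h
  have h2 : (2 : ℝ) * x.cycleType.card ≤ x.support.card := by exact_mod_cast aux_two_card x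
  have : (2 : ℝ) * x.support.card < r := by linarith
  exact_mod_cast this

theorem aux_disjoint {r : ℕ} (x y : Equiv.Perm (Fin r))
    (h : x.support.card + y.support.card ≤ r) :
    ∃ g : Equiv.Perm (Fin r), x.Disjoint (g * y * g⁻¹) := by
  have hc : y.support.card ≤ (x.supportᶜ).card := by
    rw [Finset.card_compl, Fintype.card_fin]; omega
  obtain ⟨T, hT, hTc⟩ := Finset.exists_subset_card_eq hc
  let e : {a // a ∈ y.support} ≃ {a // a ∈ T} := Finset.equivOfCardEq hTc.symm
  refine ⟨e.extendSubtype, ?_⟩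
  rw [Equiv.Perm.disjoint_iff_disjoint_support, Equiv.Perm.support_conj, Finset.disjoint_left]
  intro a ha hb
  rw [Finset.mem_map] at hb
  obtain ⟨b, hb, rfl⟩ := hb
  have := hT (e.extendSubtype_mem b hb)
  exact (Finset.mem_compl.1 this) ha

/-- If x, y are elements of the alternating group G of degree r with
Δ(x) < 1/4 and Δ(y) < 1/4, then the product set x^G·y^G contains a conjugacy class z^G
of an element z ∈ G satisfying Δ(z) = Δ(x) + Δ(y). -/
theorem class_in_product_of_small_classes {r : ℕ}
    (x y : alternatingGroup (Fin r))
    (hx : Delta (x : Equiv.Perm (Fin r)) < 1 / 4)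
    (hy : Delta (y : Equiv.Perm (Fin r)) < 1 / 4) :
    ∃ z : alternatingGroup (Fin r),
      {w : alternatingGroup (Fin r) | IsConj z w} ⊆
        {a : alternatingGroup (Fin r) | IsConj x a} *
          {b : alternatingGroup (Fin r) | IsConj y b} ∧
      Delta (z : Equiv.Perm (Fin r)) =
        Delta (x : Equiv.Perm (Fin r)) + Delta (y : Equiv.Perm (Fin r)) := by
  rcases Nat.lt_or_ge r 2 with hr | hr
  · have hs : Subsingleton (Equiv.Perm (Fin r)) := by
      have : Subsingleton (Fin r) := Fin.subsingleton_iff_le_one.2 (by omega)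
      infer_instance
    have hs' : Subsingleton (alternatingGroup (Fin r)) := inferInstance
    refine ⟨1, ?_, ?_⟩
    · intro w _
      exact Set.mem_mul.2 ⟨x, IsConj.refl x, y, IsConj.refl y, Subsingleton.elim _ _⟩
    · rw [Subsingleton.elim (x : Equiv.Perm (Fin r)) 1, Subsingleton.elim (y : Equiv.Perm (Fin r)) 1,
        Subsingleton.elim ((1 : alternatingGroup (Fin r)) : Equiv.Perm (Fin r)) 1]
      simp [aux_Delta]
  · have sx := aux_small (by omega) _ hx
    have sy := aux_small (by omega) _ hy
    obtain ⟨g, hg⟩ := aux_disjoint (x : Equiv.Perm (Fin r)) y (by omega)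
    have hy' : g * y * g⁻¹ ∈ alternatingGroup (Fin r) :=
      (inferInstance : (alternatingGroup (Fin r)).Normal).conj_mem _ y.2 g
    have hconj : IsConj (y : Equiv.Perm (Fin r)) (g * y * g⁻¹) := isConj_iff.2 ⟨g, rfl⟩
    have hyc : IsConj y ⟨g * y * g⁻¹, hy'⟩ :=
      alternatingGroup.isConj_of hconj (by rw [Fintype.card_fin]; omega)
    refine ⟨x * ⟨g * y * g⁻¹, hy'⟩, ?_, ?_⟩
    · intro w hw
      obtain ⟨c, hc⟩ := isConj_iff.1 hw
      refine Set.mem_mul.2 ⟨c * x * c⁻¹, isConj_iff.2 ⟨c, rfl⟩,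
        c * ⟨g * y * g⁻¹, hy'⟩ * c⁻¹, hyc.trans (isConj_iff.2 ⟨c, rfl⟩), ?_⟩
      rw [← hc]; group
    · change Delta ((x : Equiv.Perm (Fin r)) * (g * (y : Equiv.Perm (Fin r)) * g⁻¹)) = _
      rw [aux_Delta, aux_Delta, aux_Delta, hg.card_support_mul, hg.cycleType_mul,
        Multiset.card_add, Equiv.Perm.card_support_conj, Equiv.Perm.cycleType_conj]
      push_cast
      ring
end

section
/- For any ε > 0 there exists N such that if G is the alternating group of degree r with r ≥ N and B is a non-empty normal subset of G, then B contains a conjugacy class of G of size at least |B|^(1−ε). -/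
open Nat in
lemma aux_desc (r : ℕ) : ∀ k : ℕ, k ≤ r →
    (r : ℝ) ^ k ≤ (Real.exp 1) ^ k * (r.descFactorial k : ℝ) := by
  induction r with
  | zero => intro k hk; obtain rfl : k = 0 := by omega
            simp
  | succ r ih =>
    intro k hk
    cases k with
    | zero => simp
    | succ k =>
      have hk' : k ≤ r := by omega
      have h := ih k hk'
      rw [Nat.succ_descFactorial_succ]
      push_cast
      have key : ((r : ℝ) + 1) ^ k ≤ Real.exp 1 * (r : ℝ) ^ k := by
        rcases Nat.eq_zero_or_pos r with h0 | h0
        · obtain rfl : k = 0 := by omega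
          simp
        · have hr : (0 : ℝ) < r := by exact_mod_cast h0
          have h1 : ((r : ℝ) + 1) ≤ Real.exp (1 / r) * r := by
            have := Real.add_one_le_exp (1 / (r : ℝ))
            calc (r : ℝ) + 1 = (1 / (r : ℝ) + 1) * r := by field_simp; ring
              _ ≤ _ := by gcongr
          calc ((r : ℝ) + 1) ^ k ≤ (Real.exp (1 / r) * r) ^ k := by gcongr
            _ = Real.exp (k * (1 / r)) * (r : ℝ) ^ k := by rw [mul_pow, Real.exp_nat_mul]
            _ ≤ _ := by
              gcongr
              have : (k : ℝ) ≤ r := by exact_mod_cast hk'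
              rw [mul_one_div, div_le_one hr]; exact this
      have h2 : ((r : ℝ) + 1) ^ k ≤ Real.exp 1 * (Real.exp 1 ^ k * (r.descFactorial k : ℝ)) :=
        key.trans (by gcongr)
      calc ((r : ℝ) + 1) ^ (k + 1) = ((r : ℝ) + 1) ^ k * (r + 1) := pow_succ _ _
        _ ≤ (Real.exp 1 * (Real.exp 1 ^ k * (r.descFactorial k : ℝ))) * (r + 1) := by gcongr
        _ = _ := by ring

open Nat in
lemma aux_mult (m : Multiset ℕ) (hm : ∀ a ∈ m, 2 ≤ a) :
    m.prod ≤ 2 ^ m.sum ∧ (∏ n ∈ m.toFinset, (m.count n)!) ^ 2 ≤ m.sum ^ m.sum := by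
  constructor
  · clear hm
    induction m using Multiset.induction_on with
    | empty => simp
    | cons a s ih =>
      rw [Multiset.prod_cons, Multiset.sum_cons, pow_add]
      exact Nat.mul_le_mul (Nat.le_of_lt a.lt_two_pow_self) ih
  · have h1 : (∏ n ∈ m.toFinset, (m.count n)!) ≤ (m.card)! := by
      have := Nat.prod_factorial_dvd_factorial_sum m.toFinset (fun n => m.count n)
      rw [Multiset.toFinset_sum_count_eq] at this
      exact Nat.le_of_dvd (Nat.factorial_pos _) this
    have h2 : 2 * m.card ≤ m.sum := by
      have := Multiset.card_nsmul_le_sum hm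
      simpa [mul_comm] using this
    calc (∏ n ∈ m.toFinset, (m.count n)!) ^ 2 ≤ (m.card)! ^ 2 := by gcongr
      _ = m.card ! * m.card ! := sq _
      _ ≤ (m.card + m.card)! := Nat.le_of_dvd (Nat.factorial_pos _)
            (Nat.factorial_mul_factorial_dvd_factorial_add _ _)
      _ ≤ (m.sum)! := Nat.factorial_le (by omega)
      _ ≤ _ := Nat.factorial_le_pow _

open Nat in
lemma aux_class_s11 (r : ℕ) (g : Equiv.Perm (Fin r)) :
    ((r : ℝ) / (4 * Real.exp 1 ^ 2)) ^ g.cycleType.sum ≤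
      (Nat.card {h : Equiv.Perm (Fin r) | IsConj g h} : ℝ) ^ 2 := by
  have h := Equiv.Perm.card_isConj_mul_eq g
  have hk := Equiv.Perm.sum_cycleType_le g
  rw [Fintype.card_fin] at h hk
  obtain ⟨h1, h2⟩ := aux_mult g.cycleType (fun a ha => Equiv.Perm.two_le_of_mem_cycleType ha)
  generalize g.cycleType.sum = k at *
  generalize Nat.card {h : Equiv.Perm (Fin r) | IsConj g h} = c at *
  generalize g.cycleType.prod = P at *
  generalize (∏ n ∈ g.cycleType.toFinset, (g.cycleType.count n)!) = Q at *
  rw [← Nat.factorial_mul_descFactorial hk] at h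
  have h3 : c * (P * Q) = r.descFactorial k := by
    apply Nat.eq_of_mul_eq_mul_left (Nat.factorial_pos (r - k))
    rw [← h]; ring
  have h4 := aux_desc r k hk
  rw [← h3] at h4
  push_cast at h4
  have hP : (P : ℝ) ≤ 2 ^ k := by exact_mod_cast h1
  have hQ : (Q : ℝ) ^ 2 ≤ (r : ℝ) ^ k := by
    have : Q ^ 2 ≤ r ^ k := h2.trans (by gcongr)
    exact_mod_cast this
  rcases Nat.eq_zero_or_pos r with h0 | h0
  · obtain rfl : k = 0 := by omega
    subst h0
    have : 1 ≤ c := by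
      rcases Nat.eq_zero_or_pos c with hc | hc
      · subst hc; simp at h3
      · exact hc
    have : (1 : ℝ) ≤ c := by exact_mod_cast this
    simp only [pow_zero]
    nlinarith
  have hr : (0 : ℝ) < (r : ℝ) ^ k := by positivity
  have he : (0 : ℝ) < Real.exp 1 := Real.exp_pos 1
  rw [div_pow, div_le_iff₀ (by positivity)]
  have h5 : ((r : ℝ) ^ k) ^ 2 ≤ (c : ℝ) ^ 2 * (4 * Real.exp 1 ^ 2) ^ k * (r : ℝ) ^ k := by
    calc ((r : ℝ) ^ k) ^ 2 ≤ (Real.exp 1 ^ k * (c * (P * Q))) ^ 2 := by gcongr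
      _ = (c : ℝ) ^ 2 * (Real.exp 1 ^ k) ^ 2 * P ^ 2 * Q ^ 2 := by ring
      _ ≤ (c : ℝ) ^ 2 * (Real.exp 1 ^ k) ^ 2 * (2 ^ k) ^ 2 * (r : ℝ) ^ k := by gcongr
      _ = _ := by
        have e4 : ((2 : ℝ) ^ k) ^ 2 = 4 ^ k := by rw [← pow_mul, mul_comm, pow_mul]; norm_num
        rw [e4, mul_pow]; ring
  rw [sq ((r : ℝ) ^ k)] at h5
  exact le_of_mul_le_mul_right h5 hr

lemma aux_alt (r : ℕ) (hr : 2 ≤ r) (x : alternatingGroup (Fin r)) :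
    Nat.card {h : Equiv.Perm (Fin r) | IsConj (x : Equiv.Perm (Fin r)) h} ≤
      2 * Nat.card {y : alternatingGroup (Fin r) | IsConj x y} := by
  classical
  set C := {y : alternatingGroup (Fin r) | IsConj x y} with hC
  let t : Equiv.Perm (Fin r) := Equiv.swap ⟨0, by omega⟩ ⟨1, by omega⟩
  have ht : Equiv.Perm.sign t = -1 := Equiv.Perm.sign_swap (by simp)
  have hsub : {h : Equiv.Perm (Fin r) | IsConj (x : Equiv.Perm (Fin r)) h} ⊆
      ((fun y : alternatingGroup (Fin r) => (y : Equiv.Perm (Fin r))) '' C) ∪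
      ((fun y : alternatingGroup (Fin r) => t * (y : Equiv.Perm (Fin r)) * t⁻¹) '' C) := by
    intro y hy
    obtain ⟨g, hg⟩ := isConj_iff.1 (show IsConj (x : Equiv.Perm (Fin r)) y from hy)
    rcases Int.units_eq_one_or (Equiv.Perm.sign g) with h | h
    · left
      refine ⟨⟨g, Equiv.Perm.mem_alternatingGroup.2 h⟩ * x *
        (⟨g, Equiv.Perm.mem_alternatingGroup.2 h⟩)⁻¹, isConj_iff.2 ⟨_, rfl⟩, ?_⟩
      simpa using hg
    · right
      have h' : t⁻¹ * g ∈ alternatingGroup (Fin r) := by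
        rw [Equiv.Perm.mem_alternatingGroup]; simp [ht, h]
      refine ⟨⟨t⁻¹ * g, h'⟩ * x * (⟨t⁻¹ * g, h'⟩)⁻¹, isConj_iff.2 ⟨_, rfl⟩, ?_⟩
      rw [← hg]
      simp only [Subgroup.coe_mul, Subgroup.coe_inv]
      group
  rw [Nat.card_coe_set_eq, Nat.card_coe_set_eq]
  calc _ ≤ _ := Set.ncard_le_ncard hsub (Set.toFinite _)
    _ ≤ _ := Set.ncard_union_le _ _
    _ ≤ C.ncard + C.ncard := Nat.add_le_add (Set.ncard_image_le (Set.toFinite _))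
        (Set.ncard_image_le (Set.toFinite _))
    _ = _ := by ring

lemma aux_types (k : ℕ) (S : Finset (Multiset ℕ)) (h2 : ∀ m ∈ S, ∀ a ∈ m, 2 ≤ a)
    (hk : ∀ m ∈ S, m.sum ≤ k) : S.card ≤ 2 ^ k := by
  classical
  have hP : Fintype.card (Nat.Partition k) ≤ 2 ^ k := by
    have := Fintype.card_le_of_surjective _ (Nat.Partition.ofComposition_surj (n := k))
    rw [composition_card] at this
    exact this.trans (Nat.pow_le_pow_right (by norm_num) (by omega))
  refine le_trans ?_ hP
  rw [← Fintype.card_coe]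
  refine Fintype.card_le_of_injective (fun m : S =>
    (⟨m.1 + Multiset.replicate (k - m.1.sum) 1, ?_, ?_⟩ : Nat.Partition k)) ?_
  · intro i hi
    rcases Multiset.mem_add.1 hi with h | h
    · have := h2 _ m.2 _ h; omega
    · have := Multiset.eq_of_mem_replicate h; omega
  · have := hk _ m.2
    simp; omega
  · intro m n hmn
    have h := congrArg (fun p : Nat.Partition k => p.parts.filter (fun a => 2 ≤ a)) hmn
    simp only [Multiset.filter_add] at h
    have hr : ∀ j, (Multiset.replicate j 1).filter (fun a => 2 ≤ a) = 0 := by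
      intro j
      rw [Multiset.filter_eq_nil]
      intro a ha
      have := Multiset.eq_of_mem_replicate ha; omega
    rw [hr, hr, Multiset.filter_eq_self.2 (h2 _ m.2), Multiset.filter_eq_self.2 (h2 _ n.2)] at h
    exact Subtype.ext (by simpa using h)

/-- For any ε > 0 there exists N such that if G is the alternating
group of degree r with r ≥ N and B is a non-empty normal subset of G, then B contains a
conjugacy class of G of size at least |B|^(1−ε). -/
theorem normal_subset_contains_large_class :
    ∀ ε : ℝ, 0 < ε → ∃ N : ℕ, ∀ r : ℕ, N ≤ r →
      ∀ B : Set (alternatingGroup (Fin r)), B.Nonempty →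
        (∀ g x : alternatingGroup (Fin r), x ∈ B → g⁻¹ * x * g ∈ B) →
        ∃ x : alternatingGroup (Fin r),
          {y : alternatingGroup (Fin r) | IsConj x y} ⊆ B ∧
          (Nat.card B : ℝ) ^ (1 - ε) ≤
            (Nat.card {y : alternatingGroup (Fin r) | IsConj x y} : ℝ) := by
  classical
  intro ε hε
  refine ⟨max 2 ⌈16 * Real.exp 1 ^ 2 * (4 : ℝ) ^ (2 / ε)⌉₊, fun r hr B hB hn => ?_⟩
  have hr2 : 2 ≤ r := le_trans (le_max_left _ _) hr
  have hrK : 16 * Real.exp 1 ^ 2 * (4 : ℝ) ^ (2 / ε) ≤ r :=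
    (Nat.le_ceil _).trans (by exact_mod_cast le_trans (le_max_right _ _) hr)
  let cl : alternatingGroup (Fin r) → ℕ :=
    fun x => Nat.card {y : alternatingGroup (Fin r) | IsConj x y}
  let F : Finset (alternatingGroup (Fin r)) := B.toFinite.toFinset
  have hF : ∀ x, x ∈ F ↔ x ∈ B := fun x => Set.Finite.mem_toFinset _
  have hFne : F.Nonempty := by obtain ⟨x, hx⟩ := hB; exact ⟨x, (hF x).2 hx⟩
  have hcardB : Nat.card B = F.card := by
    rw [Nat.card_coe_set_eq]; exact Set.ncard_eq_toFinset_card B B.toFinite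
  obtain ⟨x, hxF, hx⟩ := Finset.exists_max_image F cl hFne
  let ct : alternatingGroup (Fin r) → Multiset ℕ :=
    fun y => (y : Equiv.Perm (Fin r)).cycleType
  obtain ⟨z, hzF, hz⟩ := Finset.exists_max_image F (fun y => (ct y).sum) hFne
  have hclpos : ∀ y, 1 ≤ cl y := by
    intro y
    have : Nonempty {w : alternatingGroup (Fin r) | IsConj y w} := ⟨⟨y, IsConj.refl y⟩⟩
    exact Nat.card_pos
  refine ⟨x, ?_, ?_⟩
  · intro y hy
    obtain ⟨g, hg⟩ := isConj_iff.1 (show IsConj x y from hy)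
    have := hn g⁻¹ x ((hF x).1 hxF)
    rw [inv_inv, hg] at this
    exact this
  change _ ≤ (cl x : ℝ)
  have hc1 : (1 : ℝ) ≤ cl x := by exact_mod_cast hclpos x
  have hB1 : (1 : ℝ) ≤ (Nat.card B : ℝ) := by
    rw [hcardB]; exact_mod_cast hFne.card_pos
  by_cases hε1 : 1 ≤ ε
  · exact (Real.rpow_le_one_of_one_le_of_nonpos hB1 (by linarith)).trans hc1
  push Not at hε1
  set k := (ct z).sum with hkdef
  -- count
  have hcount : F.card ≤ 2 * cl x * 2 ^ k := by
    have h1 : F.card ≤ (2 * cl x) * (F.image ct).card := by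
      refine Finset.card_le_mul_card_image F _ ?_
      intro τ hτ
      obtain ⟨y, hy, rfl⟩ := Finset.mem_image.1 hτ
      refine le_trans ?_ ((aux_alt r hr2 y).trans (Nat.mul_le_mul_left 2 (hx y hy)))
      rw [Nat.card_coe_set_eq, ← Set.ncard_coe_finset]
      refine Set.ncard_le_ncard_of_injOn (fun w => (w : Equiv.Perm (Fin r))) ?_
        (Subtype.val_injective.injOn) (Set.toFinite _)
      intro w hw
      have hw' := (Finset.mem_filter.1 (Finset.mem_coe.1 hw)).2
      exact Equiv.Perm.isConj_iff_cycleType_eq.2 hw'.symm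
    refine h1.trans (Nat.mul_le_mul_left _ (aux_types k _ ?_ ?_))
    · intro m hm a ha
      obtain ⟨y, hy, rfl⟩ := Finset.mem_image.1 hm
      exact Equiv.Perm.two_le_of_mem_cycleType ha
    · intro m hm
      obtain ⟨y, hy, rfl⟩ := Finset.mem_image.1 hm
      exact hz y hy
  rcases Nat.eq_zero_or_pos k with hk0 | hk0
  · have hone : F.card ≤ 1 := by
      rw [Finset.card_le_one]
      have : ∀ a ∈ F, a = 1 := by
        intro a ha
        have h := hz a ha
        have h0 : (ct a).sum = 0 := by
          have h' : (ct a).sum ≤ k := h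
          omega
        have h0' : (a : Equiv.Perm (Fin r)).cycleType.sum = 0 := h0
        rw [Equiv.Perm.sum_cycleType, Finset.card_eq_zero, Equiv.Perm.support_eq_empty_iff] at h0'
        exact Subtype.ext h0'
      intro a ha b hb
      rw [this a ha, this b hb]
    have : (Nat.card B : ℝ) = 1 := by
      apply le_antisymm _ hB1
      rw [hcardB]; exact_mod_cast hone
    rw [this, Real.one_rpow]; exact hc1
  have hcount4 : (Nat.card B : ℝ) ≤ 4 ^ k * cl x := by
    rw [hcardB]
    have : F.card ≤ 4 ^ k * cl x := by
      refine hcount.trans ?_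
      have h2 : 2 * 2 ^ k ≤ 4 ^ k := by
        rw [show 4 = 2 * 2 by norm_num, mul_pow]
        exact Nat.mul_le_mul_right _ (Nat.le_self_pow (by omega) 2)
      calc 2 * cl x * 2 ^ k = (2 * 2 ^ k) * cl x := by ring
        _ ≤ _ := Nat.mul_le_mul_right _ h2
    exact_mod_cast this
  have he : (0 : ℝ) < Real.exp 1 := Real.exp_pos 1
  have hcl : ((4 : ℝ) ^ (2 / ε)) ^ k ≤ (cl x : ℝ) ^ 2 := by
    have h1 := aux_class_s11 r (z : Equiv.Perm (Fin r))
    have h2 : (Nat.card {h : Equiv.Perm (Fin r) | IsConj (z : Equiv.Perm (Fin r)) h} : ℝ)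
        ≤ 2 * cl x := by
      exact_mod_cast (aux_alt r hr2 z).trans (Nat.mul_le_mul_left 2 (hx z hzF))
    have h3 : ((r : ℝ) / (4 * Real.exp 1 ^ 2)) ^ k ≤ (2 * cl x : ℝ) ^ 2 := by
      refine h1.trans ?_
      gcongr
    have h4 : 4 * (4 : ℝ) ^ (2 / ε) ≤ (r : ℝ) / (4 * Real.exp 1 ^ 2) := by
      rw [le_div_iff₀ (by positivity)]
      linarith
    have h5 : (4 * (4 : ℝ) ^ (2 / ε)) ^ k ≤ (2 * cl x : ℝ) ^ 2 :=
      le_trans (by gcongr) h3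
    rw [mul_pow, mul_pow] at h5
    have h6 : (4 : ℝ) ≤ 4 ^ k := le_self_pow₀ (by norm_num) (by omega)
    have h7 : (0 : ℝ) < ((4 : ℝ) ^ (2 / ε)) ^ k := by positivity
    nlinarith
  have h4k : (4 : ℝ) ^ k ≤ (cl x : ℝ) ^ ε := by
    have h := Real.rpow_le_rpow (by positivity) hcl (show 0 ≤ ε / 2 by positivity)
    rw [← Real.rpow_natCast, ← Real.rpow_natCast, ← Real.rpow_mul (by positivity),
      ← Real.rpow_mul (by positivity), ← Real.rpow_mul (by positivity)] at h
    have e1 : 2 / ε * ((k : ℝ) * (ε / 2)) = k := by field_simp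
    have e2 : ((2 : ℕ) : ℝ) * (ε / 2) = ε := by push_cast; ring
    rw [e1, e2, Real.rpow_natCast] at h
    exact h
  have hpos : (0 : ℝ) < cl x := by linarith
  calc (Nat.card B : ℝ) ^ (1 - ε) ≤ ((cl x : ℝ) ^ (ε + 1)) ^ (1 - ε) := by
        apply Real.rpow_le_rpow (by positivity) _ (by linarith)
        rw [Real.rpow_add hpos, Real.rpow_one]
        exact hcount4.trans (by gcongr)
    _ = (cl x : ℝ) ^ ((ε + 1) * (1 - ε)) := (Real.rpow_mul hpos.le _ _).symm
    _ ≤ (cl x : ℝ) ^ (1 : ℝ) := Real.rpow_le_rpow_of_exponent_le hc1 (by nlinarith)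
    _ = cl x := Real.rpow_one _
end

section
/- Let G be a group and let B be a finite normal subset of G. If |B²| ≤ K·|B| for some positive real number K, then |B^k| ≤ K^k·|B| for every integer k ≥ 1. -/
open Pointwise

theorem aux_growth {G : Type} [Group G] [DecidableEq G] (B : Finset G) (hne : B.Nonempty)
    (hc : ∀ A : Finset G, A * B = B * A) (K : ℝ)
    (h : ((B ^ 2).card : ℝ) ≤ K * (B.card : ℝ)) (k : ℕ) :
    ((B ^ k).card : ℝ) ≤ K ^ k * (B.card : ℝ) := by
  have hB' : B ∈ B.powerset.erase ∅ :=
    Finset.mem_erase_of_ne_of_mem hne.ne_empty (Finset.mem_powerset_self _)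
  obtain ⟨A, hA, hmin⟩ := Finset.exists_min_image (B.powerset.erase ∅)
    (fun U => ((U * B).card : ℝ) / (U.card : ℝ)) ⟨B, hB'⟩
  rw [Finset.mem_erase, Finset.mem_powerset, ← Finset.nonempty_iff_ne_empty] at hA
  obtain ⟨hA, hAB⟩ := hA
  have hA0 : (0 : ℝ) < A.card := Nat.cast_pos.2 hA.card_pos
  have hB0 : (0 : ℝ) < B.card := Nat.cast_pos.2 hne.card_pos
  have hp : ∀ A' ⊆ A, (A * B).card * A'.card ≤ (A' * B).card * A.card := by
    intro A' hA'
    obtain rfl | hn := A'.eq_empty_or_nonempty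
    · simp
    have hn0 : (0 : ℝ) < A'.card := Nat.cast_pos.2 hn.card_pos
    exact_mod_cast (div_le_div_iff₀ hA0 hn0).1 (hmin _
      (Finset.mem_erase_of_ne_of_mem hn.ne_empty (Finset.mem_powerset.2 (hA'.trans hAB))))
  have hK : ((A * B).card : ℝ) ≤ K * A.card := by
    rw [← div_le_iff₀ hA0]
    refine (hmin B hB').trans ?_
    rw [div_le_iff₀ hB0, ← pow_two]
    exact h
  have hK0 : 0 ≤ K := by
    by_contra hneg
    have h1 : (0 : ℝ) ≤ ((A * B).card : ℝ) := Nat.cast_nonneg _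
    nlinarith
  have hcp : ∀ n : ℕ, ∀ A : Finset G, A * B ^ n = B ^ n * A := by
    intro n
    induction n with
    | zero => simp
    | succ n ih => intro A; rw [pow_succ, ← mul_assoc, ih, mul_assoc, hc, mul_assoc]
  have key : ∀ n : ℕ, ((B ^ n * A).card : ℝ) ≤ K ^ n * A.card := by
    intro n
    induction n with
    | zero => simp
    | succ n ih =>
      refine le_of_mul_le_mul_right ?_ hA0
      have e : B ^ (n + 1) * A = B ^ n * A * B := by
        rw [pow_succ, mul_assoc, ← hc, mul_assoc]
      have h2 : (((B ^ n * A * B).card : ℝ)) * A.card ≤ (A * B).card * (B ^ n * A).card := by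
        exact_mod_cast Finset.pluennecke_petridis_inequality_mul (B ^ n) hp
      rw [e]
      calc _ ≤ _ := h2
        _ ≤ (K * A.card) * (K ^ n * A.card) := by gcongr
        _ = _ := by ring
  calc ((B ^ k).card : ℝ) ≤ (B ^ k * A).card := by
        exact_mod_cast Finset.card_le_card_mul_right hA
    _ ≤ K ^ k * A.card := key k
    _ ≤ K ^ k * B.card := by gcongr

/-- Let G be a group and let B be a finite normal subset of G. If
|B²| ≤ K·|B| for some positive real K, then |B^k| ≤ K^k·|B| for every integer k ≥ 1. -/
theorem normal_subset_power_growth {G : Type} [Group G]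
    (B : Set G) (hB : B.Finite)
    (hBnormal : ∀ g x : G, x ∈ B → g⁻¹ * x * g ∈ B)
    (K : ℝ) (hK : 0 < K)
    (h : (Nat.card ↥(B ^ 2) : ℝ) ≤ K * (Nat.card B : ℝ)) :
    ∀ k : ℕ, 1 ≤ k → (Nat.card ↥(B ^ k) : ℝ) ≤ K ^ k * (Nat.card B : ℝ) := by
  classical
  intro k hk
  lift B to Finset G using hB
  have hcard : ∀ n : ℕ, Nat.card ↥((B : Set G) ^ n) = (B ^ n).card := by
    intro n
    rw [← Finset.coe_pow, Nat.card_coe_set_eq, Set.ncard_coe_finset]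
  have hcard1 : Nat.card ↥(B : Set G) = B.card := by
    rw [Nat.card_coe_set_eq, Set.ncard_coe_finset]
  rw [hcard, hcard1] at h ⊢
  obtain rfl | hne := B.eq_empty_or_nonempty
  · rw [Finset.empty_pow (by omega)]; simp
  refine aux_growth B hne ?_ K h k
  intro A
  ext x
  simp only [Finset.mem_mul]
  constructor
  · rintro ⟨a, ha, b, hb, rfl⟩
    exact ⟨a * b * a⁻¹, by simpa using hBnormal a⁻¹ b (by simpa using hb), a, ha, by group⟩
  · rintro ⟨b, hb, a, ha, rfl⟩
    exact ⟨a, ha, a⁻¹ * b * a, by simpa using hBnormal a b (by simpa using hb), by group⟩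
end
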